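/- arXiv:0909.1486 — 2 statements merged into one kernel-verified Lean document; each statement's English description precedes it below -/
import Mathlib

section
/- A category 𝒜 equipped with bifunctors ⊕, ⊗ and constraint isomorphisms is a symmetric Ann-category if and only if: (i) it is a ring-like category, and (ii) every object of (𝒜,⊕) is invertible with respect to ⊕ and the underlying category of (𝒜,⊕) is a groupoid; in the 'if' direction the right distributivity constraint is given by ℜ_{X,Y,A} := (c_{A,X}⊕c_{A,Y})∘𝔏_{A,X,Y}∘c_{A,X⊕Y}^{-1}. -/
open CategoryTheory

universe v u

namespace AnnCat

variable (C : Type u) [Category.{v} C]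

/-- A bifunctor `C × C → C`, given by object and morphism assignments. -/
structure Bifunc where
  obj : C → C → C
  map : ∀ {A B X Y : C}, (A ⟶ B) → (X ⟶ Y) → (obj A X ⟶ obj B Y)
  map_id : ∀ (A X : C), map (𝟙 A) (𝟙 X) = 𝟙 (obj A X)
  map_comp : ∀ {A B E X Y Z : C} (f : A ⟶ B) (g : B ⟶ E) (h : X ⟶ Y) (k : Y ⟶ Z),
      map (f ≫ g) (h ≫ k) = map f h ≫ map g k

/-- All the data of a braided Ann-category: two bifunctors `⊕` (`pl`) and `⊗` (`tn`),
objects `0`, `1`, and the natural isomorphisms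
`a⁺` (`aP`), `c⁺` (`cP`), `g`, `d`, `a`, `l`, `r`, `𝔏` (`dl`), `ℜ` (`dr`) and the braiding `c` (`br`). -/
structure Data where
  pl : Bifunc C
  tn : Bifunc C
  zero : C
  one : C
  aP : ∀ A B X : C, pl.obj A (pl.obj B X) ≅ pl.obj (pl.obj A B) X
  cP : ∀ A B : C, pl.obj A B ≅ pl.obj B A
  g : ∀ A : C, pl.obj zero A ≅ A
  d : ∀ A : C, pl.obj A zero ≅ A
  a : ∀ A B X : C, tn.obj A (tn.obj B X) ≅ tn.obj (tn.obj A B) X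
  l : ∀ A : C, tn.obj one A ≅ A
  r : ∀ A : C, tn.obj A one ≅ A
  dl : ∀ A X Y : C, tn.obj A (pl.obj X Y) ≅ pl.obj (tn.obj A X) (tn.obj A Y)
  dr : ∀ X Y A : C, tn.obj (pl.obj X Y) A ≅ pl.obj (tn.obj X A) (tn.obj Y A)
  br : ∀ A B : C, tn.obj A B ≅ tn.obj B A
  natAP : ∀ {A A' B B' X X' : C} (f : A ⟶ A') (h : B ⟶ B') (k : X ⟶ X'),
      pl.map f (pl.map h k) ≫ (aP A' B' X').hom = (aP A B X).hom ≫ pl.map (pl.map f h) k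
  natCP : ∀ {A A' B B' : C} (f : A ⟶ A') (h : B ⟶ B'),
      pl.map f h ≫ (cP A' B').hom = (cP A B).hom ≫ pl.map h f
  natG : ∀ {A A' : C} (f : A ⟶ A'), pl.map (𝟙 zero) f ≫ (g A').hom = (g A).hom ≫ f
  natD : ∀ {A A' : C} (f : A ⟶ A'), pl.map f (𝟙 zero) ≫ (d A').hom = (d A).hom ≫ f
  natA : ∀ {A A' B B' X X' : C} (f : A ⟶ A') (h : B ⟶ B') (k : X ⟶ X'),
      tn.map f (tn.map h k) ≫ (a A' B' X').hom = (a A B X).hom ≫ tn.map (tn.map f h) k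
  natL : ∀ {A A' : C} (f : A ⟶ A'), tn.map (𝟙 one) f ≫ (l A').hom = (l A).hom ≫ f
  natR : ∀ {A A' : C} (f : A ⟶ A'), tn.map f (𝟙 one) ≫ (r A').hom = (r A).hom ≫ f
  natDL : ∀ {A A' X X' Y Y' : C} (f : A ⟶ A') (h : X ⟶ X') (k : Y ⟶ Y'),
      tn.map f (pl.map h k) ≫ (dl A' X' Y').hom
        = (dl A X Y).hom ≫ pl.map (tn.map f h) (tn.map f k)
  natDR : ∀ {X X' Y Y' A A' : C} (h : X ⟶ X') (k : Y ⟶ Y') (f : A ⟶ A'),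
      tn.map (pl.map h k) f ≫ (dr X' Y' A').hom
        = (dr X Y A).hom ≫ pl.map (tn.map h f) (tn.map k f)
  natBr : ∀ {A A' B B' : C} (f : A ⟶ A') (h : B ⟶ B'),
      tn.map f h ≫ (br A' B').hom = (br A B).hom ≫ tn.map h f

variable {C}

/-- The canonical "middle four interchange" morphism
`v : (U⊕V)⊕(Z⊕T) → (U⊕Z)⊕(V⊕T)` built from `a⁺`, `c⁺`, `id`. -/
def v (D : Data C) (U V Z T : C) :
    D.pl.obj (D.pl.obj U V) (D.pl.obj Z T) ⟶ D.pl.obj (D.pl.obj U Z) (D.pl.obj V T) :=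
  (D.aP U V (D.pl.obj Z T)).inv ≫
    D.pl.map (𝟙 U)
      ((D.aP V Z T).hom ≫ D.pl.map (D.cP V Z).hom (𝟙 T) ≫ (D.aP Z V T).inv) ≫
    (D.aP U Z (D.pl.obj V T)).hom

/-! Coherence axioms for `(𝒜, ⊕, a⁺, c⁺, (0,g,d))`. -/

def pentP (D : Data C) : Prop := ∀ W X Y Z : C,
  D.pl.map (𝟙 W) (D.aP X Y Z).hom ≫ (D.aP W (D.pl.obj X Y) Z).hom
      ≫ D.pl.map (D.aP W X Y).hom (𝟙 Z)
    = (D.aP W X (D.pl.obj Y Z)).hom ≫ (D.aP (D.pl.obj W X) Y Z).hom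

def triP (D : Data C) : Prop := ∀ X Y : C,
  (D.aP X D.zero Y).hom ≫ D.pl.map (D.d X).hom (𝟙 Y) = D.pl.map (𝟙 X) (D.g Y).hom

def hexP (D : Data C) : Prop := ∀ X Y Z : C,
  (D.aP X Y Z).inv ≫ (D.cP X (D.pl.obj Y Z)).hom ≫ (D.aP Y Z X).inv
    = D.pl.map (D.cP X Y).hom (𝟙 Z) ≫ (D.aP Y X Z).inv ≫ D.pl.map (𝟙 Y) (D.cP X Z).hom

def symP (D : Data C) : Prop := ∀ A B : C,
  (D.cP A B).hom ≫ (D.cP B A).hom = 𝟙 (D.pl.obj A B)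

/-- Every object has an inverse with respect to `⊕`. -/
def invObjP (D : Data C) : Prop := ∀ A : C, ∃ A' : C, Nonempty (D.pl.obj A A' ≅ D.zero)

/-- The underlying category is a groupoid. -/
def grpdP (C : Type u) [Category.{v} C] : Prop := ∀ {X Y : C} (f : X ⟶ Y), IsIso f

/-! Coherence axioms for `(𝒜, ⊗, a, (1,l,r))` and the braiding `c`. -/

def pentT (D : Data C) : Prop := ∀ W X Y Z : C,
  D.tn.map (𝟙 W) (D.a X Y Z).hom ≫ (D.a W (D.tn.obj X Y) Z).hom
      ≫ D.tn.map (D.a W X Y).hom (𝟙 Z)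
    = (D.a W X (D.tn.obj Y Z)).hom ≫ (D.a (D.tn.obj W X) Y Z).hom

def triT (D : Data C) : Prop := ∀ X Y : C,
  (D.a X D.one Y).hom ≫ D.tn.map (D.r X).hom (𝟙 Y) = D.tn.map (𝟙 X) (D.l Y).hom

/-- First hexagon axiom (B1) for the braiding. -/
def hexT1 (D : Data C) : Prop := ∀ X Y Z : C,
  (D.a X Y Z).inv ≫ (D.br X (D.tn.obj Y Z)).hom ≫ (D.a Y Z X).inv
    = D.tn.map (D.br X Y).hom (𝟙 Z) ≫ (D.a Y X Z).inv ≫ D.tn.map (𝟙 Y) (D.br X Z).hom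

/-- Second hexagon axiom (B2) for the braiding. -/
def hexT2 (D : Data C) : Prop := ∀ X Y Z : C,
  (D.a X Y Z).hom ≫ (D.br (D.tn.obj X Y) Z).hom ≫ (D.a Z X Y).hom
    = D.tn.map (𝟙 X) (D.br Y Z).hom ≫ (D.a X Z Y).hom ≫ D.tn.map (D.br X Z).hom (𝟙 Y)

/-- The braiding is a symmetry. -/
def symT (D : Data C) : Prop := ∀ A B : C,
  (D.br A B).hom ≫ (D.br B A).hom = 𝟙 (D.tn.obj A B)

/-- Compatibility of the braiding with the unit constraint `(1,l,r)`. -/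
def brUnit (D : Data C) : Prop := ∀ A : C,
  (D.br D.one A).hom ≫ (D.r A).hom = (D.l A).hom

/-! Axiom (Ann-1): compatibility of `(L^A, 𝔏)` and `(R^A, ℜ)` with `a⁺` and `c⁺`. -/

def compLaP (D : Data C) : Prop := ∀ A X Y Z : C,
  D.tn.map (𝟙 A) (D.aP X Y Z).hom ≫ (D.dl A (D.pl.obj X Y) Z).hom
      ≫ D.pl.map (D.dl A X Y).hom (𝟙 (D.tn.obj A Z))
    = (D.dl A X (D.pl.obj Y Z)).hom ≫ D.pl.map (𝟙 (D.tn.obj A X)) (D.dl A Y Z).hom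
      ≫ (D.aP (D.tn.obj A X) (D.tn.obj A Y) (D.tn.obj A Z)).hom

def compLcP (D : Data C) : Prop := ∀ A X Y : C,
  (D.dl A X Y).hom ≫ (D.cP (D.tn.obj A X) (D.tn.obj A Y)).hom
    = D.tn.map (𝟙 A) (D.cP X Y).hom ≫ (D.dl A Y X).hom

def compRaP (D : Data C) : Prop := ∀ X Y Z A : C,
  D.tn.map (D.aP X Y Z).hom (𝟙 A) ≫ (D.dr (D.pl.obj X Y) Z A).hom
      ≫ D.pl.map (D.dr X Y A).hom (𝟙 (D.tn.obj Z A))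
    = (D.dr X (D.pl.obj Y Z) A).hom ≫ D.pl.map (𝟙 (D.tn.obj X A)) (D.dr Y Z A).hom
      ≫ (D.aP (D.tn.obj X A) (D.tn.obj Y A) (D.tn.obj Z A)).hom

def compRcP (D : Data C) : Prop := ∀ X Y A : C,
  (D.dr X Y A).hom ≫ (D.cP (D.tn.obj X A) (D.tn.obj Y A)).hom
    = D.tn.map (D.cP X Y).hom (𝟙 A) ≫ (D.dr Y X A).hom

/-! Axiom (Ann-2): diagrams (1)-(4); axiom (Ann-3): diagrams (5.1), (5.2). -/

def diag1 (D : Data C) : Prop := ∀ A B X Y : C,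
  (D.a A B (D.pl.obj X Y)).hom ≫ (D.dl (D.tn.obj A B) X Y).hom
    = D.tn.map (𝟙 A) (D.dl B X Y).hom ≫ (D.dl A (D.tn.obj B X) (D.tn.obj B Y)).hom
      ≫ D.pl.map (D.a A B X).hom (D.a A B Y).hom

def diag2 (D : Data C) : Prop := ∀ X Y B A : C,
  (D.a (D.pl.obj X Y) B A).hom ≫ D.tn.map (D.dr X Y B).hom (𝟙 A)
      ≫ (D.dr (D.tn.obj X B) (D.tn.obj Y B) A).hom
    = (D.dr X Y (D.tn.obj B A)).hom ≫ D.pl.map (D.a X B A).hom (D.a Y B A).hom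

def diag3 (D : Data C) : Prop := ∀ A X Y B : C,
  (D.a A (D.pl.obj X Y) B).hom ≫ D.tn.map (D.dl A X Y).hom (𝟙 B)
      ≫ (D.dr (D.tn.obj A X) (D.tn.obj A Y) B).hom
    = D.tn.map (𝟙 A) (D.dr X Y B).hom ≫ (D.dl A (D.tn.obj X B) (D.tn.obj Y B)).hom
      ≫ D.pl.map (D.a A X B).hom (D.a A Y B).hom

def diag4 (D : Data C) : Prop := ∀ A B X Y : C,
  (D.dl (D.pl.obj A B) X Y).hom ≫ D.pl.map (D.dr A B X).hom (D.dr A B Y).hom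
      ≫ v D (D.tn.obj A X) (D.tn.obj B X) (D.tn.obj A Y) (D.tn.obj B Y)
    = (D.dr A B (D.pl.obj X Y)).hom ≫ D.pl.map (D.dl A X Y).hom (D.dl B X Y).hom

def diag51 (D : Data C) : Prop := ∀ X Y : C,
  (D.dl D.one X Y).hom ≫ D.pl.map (D.l X).hom (D.l Y).hom = (D.l (D.pl.obj X Y)).hom

def diag52 (D : Data C) : Prop := ∀ X Y : C,
  (D.dr X Y D.one).hom ≫ D.pl.map (D.r X).hom (D.r Y).hom = (D.r (D.pl.obj X Y)).hom

/-- Diagram (6) of a braided Ann-category: `(c_{A,X} ⊕ c_{A,Y}) ∘ 𝔏_{A,X,Y} = ℜ_{X,Y,A} ∘ c_{A,X⊕Y}`. -/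
def diag6 (D : Data C) : Prop := ∀ A X Y : C,
  (D.dl A X Y).hom ≫ D.pl.map (D.br A X).hom (D.br A Y).hom
    = (D.br A (D.pl.obj X Y)).hom ≫ (D.dr X Y A).hom

/-- The condition `c_{0,0} = id`. -/
def c00 (D : Data C) : Prop := (D.br D.zero D.zero).hom = 𝟙 (D.tn.obj D.zero D.zero)

/-- The axioms of an Ann-category. -/
structure IsAnn (D : Data C) : Prop where
  hPentP : pentP D
  hTriP : triP D
  hHexP : hexP D
  hSymP : symP D
  hGrpd : grpdP C
  hInv : invObjP D
  hPentT : pentT D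
  hTriT : triT D
  hCompLaP : compLaP D
  hCompLcP : compLcP D
  hCompRaP : compRaP D
  hCompRcP : compRcP D
  hD1 : diag1 D
  hD2 : diag2 D
  hD3 : diag3 D
  hD4 : diag4 D
  hD51 : diag51 D
  hD52 : diag52 D

/-- The axioms of a braided Ann-category. -/
structure IsBraidedAnn (D : Data C) extends IsAnn D : Prop where
  hHex1 : hexT1 D
  hHex2 : hexT2 D
  hD6 : diag6 D
  hC00 : c00 D

/-- A symmetric Ann-category: a braided Ann-category whose braiding is a symmetry. -/
def IsSymAnn (D : Data C) : Prop := IsBraidedAnn D ∧ symT D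

/-- `(L^A, 𝔏, L̂^A)` is a `⊕`-functor compatible with the unit constraints (a U-functor). -/
def isUL (D : Data C) (hatL : ∀ A : C, D.tn.obj A D.zero ≅ D.zero) : Prop := ∀ A X : C,
  ((D.dl A D.zero X).hom ≫ D.pl.map (hatL A).hom (𝟙 (D.tn.obj A X))
      ≫ (D.g (D.tn.obj A X)).hom = D.tn.map (𝟙 A) (D.g X).hom) ∧
  ((D.dl A X D.zero).hom ≫ D.pl.map (𝟙 (D.tn.obj A X)) (hatL A).hom
      ≫ (D.d (D.tn.obj A X)).hom = D.tn.map (𝟙 A) (D.d X).hom)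

/-- `(R^A, ℜ, R̂^A)` is a `⊕`-functor compatible with the unit constraints (a U-functor). -/
def isUR (D : Data C) (hatR : ∀ A : C, D.tn.obj D.zero A ≅ D.zero) : Prop := ∀ A X : C,
  ((D.dr D.zero X A).hom ≫ D.pl.map (hatR A).hom (𝟙 (D.tn.obj X A))
      ≫ (D.g (D.tn.obj X A)).hom = D.tn.map (D.g X).hom (𝟙 A)) ∧
  ((D.dr X D.zero A).hom ≫ D.pl.map (𝟙 (D.tn.obj X A)) (hatR A).hom
      ≫ (D.d (D.tn.obj X A)).hom = D.tn.map (D.d X).hom (𝟙 A))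

end AnnCat

namespace AnnCat

variable {C : Type u} [Category.{v} C]

/-- The data of a distributivity category: the data of a (braided) Ann-category together with
natural isomorphisms `L̂^A : A ⊗ O → O` and `R̂^A : O ⊗ A → O`. -/
structure DistData (C : Type u) [Category.{v} C] extends Data C where
  hatL : ∀ A : C, tn.obj A zero ≅ zero
  hatR : ∀ A : C, tn.obj zero A ≅ zero

/-! Laplaza's axioms (L1)-(L13). -/

def L1ax (E : DistData C) : Prop := (E.hatL E.zero).hom = (E.hatR E.zero).hom

def L2ax (E : DistData C) : Prop := ∀ A B : C,
  (E.hatR (E.pl.obj A B)).hom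
    = (E.dl E.zero A B).hom ≫ E.pl.map (E.hatR A).hom (E.hatR B).hom ≫ (E.g E.zero).hom

def L3ax (E : DistData C) : Prop := ∀ A B : C,
  (E.hatL (E.pl.obj A B)).hom
    = (E.dr A B E.zero).hom ≫ E.pl.map (E.hatL A).hom (E.hatL B).hom ≫ (E.d E.zero).hom

def L4ax (E : DistData C) : Prop := (E.hatL E.one).hom = (E.l E.zero).hom

def L5ax (E : DistData C) : Prop := (E.hatR E.one).hom = (E.r E.zero).hom

def L6ax (E : DistData C) : Prop := ∀ A : C,
  (E.hatL A).hom = (E.br A E.zero).hom ≫ (E.hatR A).hom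

def L7ax (E : DistData C) : Prop := ∀ A B : C,
  (E.hatR (E.tn.obj A B)).hom
    = (E.a E.zero A B).hom ≫ E.tn.map (E.hatR A).hom (𝟙 B) ≫ (E.hatR B).hom

def L8ax (E : DistData C) : Prop := ∀ A B : C,
  E.tn.map (𝟙 A) (E.hatR B).hom ≫ (E.hatL A).hom
    = (E.a A E.zero B).hom ≫ E.tn.map (E.hatL A).hom (𝟙 B) ≫ (E.hatR B).hom

def L9ax (E : DistData C) : Prop := ∀ A B : C,
  (E.a A B E.zero).hom ≫ (E.hatL (E.tn.obj A B)).hom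
    = E.tn.map (𝟙 A) (E.hatL B).hom ≫ (E.hatL A).hom

def L10ax (E : DistData C) : Prop := ∀ A B : C,
  (E.dl A E.zero B).hom ≫ E.pl.map (E.hatL A).hom (𝟙 (E.tn.obj A B))
      ≫ (E.g (E.tn.obj A B)).hom = E.tn.map (𝟙 A) (E.g B).hom

def L11ax (E : DistData C) : Prop := ∀ A B : C,
  (E.dr E.zero B A).hom ≫ E.pl.map (E.hatR A).hom (𝟙 (E.tn.obj B A))
      ≫ (E.g (E.tn.obj B A)).hom = E.tn.map (E.g B).hom (𝟙 A)

def L12ax (E : DistData C) : Prop := ∀ A B : C,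
  (E.dl A B E.zero).hom ≫ E.pl.map (𝟙 (E.tn.obj A B)) (E.hatL A).hom
      ≫ (E.d (E.tn.obj A B)).hom = E.tn.map (𝟙 A) (E.d B).hom

def L13ax (E : DistData C) : Prop := ∀ A B : C,
  (E.dr A E.zero B).hom ≫ E.pl.map (𝟙 (E.tn.obj A B)) (E.hatR B).hom
      ≫ (E.d (E.tn.obj A B)).hom = E.tn.map (E.d A).hom (𝟙 B)

/-- The axioms of a distributivity category other than (L1)-(L13): both symmetric monoidal
structures are coherent, `(L^A, 𝔏)` and `(R^A, ℜ)` are `⊕`-functors compatible with `a⁺`, `c⁺`,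
`L̂`, `R̂` are natural, and the diagrams (1)-(4), (5.1), (5.2), (6) commute. -/
structure DistCore (E : DistData C) : Prop where
  hPentP : pentP E.toData
  hTriP : triP E.toData
  hHexP : hexP E.toData
  hSymP : symP E.toData
  hPentT : pentT E.toData
  hTriT : triT E.toData
  hHexT1 : hexT1 E.toData
  hHexT2 : hexT2 E.toData
  hSymT : symT E.toData
  hNatHatL : ∀ {A A' : C} (f : A ⟶ A'),
      E.tn.map f (𝟙 E.zero) ≫ (E.hatL A').hom = (E.hatL A).hom
  hNatHatR : ∀ {A A' : C} (f : A ⟶ A'),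
      E.tn.map (𝟙 E.zero) f ≫ (E.hatR A').hom = (E.hatR A).hom
  hCompLaP : compLaP E.toData
  hCompLcP : compLcP E.toData
  hCompRaP : compRaP E.toData
  hCompRcP : compRcP E.toData
  hD1 : diag1 E.toData
  hD2 : diag2 E.toData
  hD3 : diag3 E.toData
  hD4 : diag4 E.toData
  hD51 : diag51 E.toData
  hD52 : diag52 E.toData
  hD6 : diag6 E.toData

/-- A distributivity category in the sense of Laplaza. -/
structure IsDistCat (E : DistData C) extends DistCore E : Prop where
  hL1 : L1ax E
  hL2 : L2ax E
  hL3 : L3ax E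
  hL4 : L4ax E
  hL5 : L5ax E
  hL6 : L6ax E
  hL7 : L7ax E
  hL8 : L8ax E
  hL9 : L9ax E
  hL10 : L10ax E
  hL11 : L11ax E
  hL12 : L12ax E
  hL13 : L13ax E

/-- The Fröhlich–Wall diagram (8). -/
def diag8 (D : Data C) : Prop := ∀ A B X Y : C,
  (D.dl (D.pl.obj X Y) A B).hom
      ≫ D.pl.map (D.br (D.pl.obj X Y) A).hom (D.br (D.pl.obj X Y) B).hom
      ≫ D.pl.map (D.dl A X Y).hom (D.dl B X Y).hom
      ≫ v D (D.tn.obj A X) (D.tn.obj A Y) (D.tn.obj B X) (D.tn.obj B Y)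
      ≫ D.pl.map (D.pl.map (D.br A X).hom (D.br B X).hom)
          (D.pl.map (D.br A Y).hom (D.br B Y).hom)
    = (D.br (D.pl.obj X Y) (D.pl.obj A B)).hom ≫ (D.dl (D.pl.obj A B) X Y).hom
      ≫ D.pl.map (D.br (D.pl.obj A B) X).hom (D.br (D.pl.obj A B) Y).hom
      ≫ D.pl.map (D.dl X A B).hom (D.dl Y A B).hom

/-- A ring-like category in the sense of Fröhlich and Wall: two coherent symmetric monoidal
structures `(𝒜,⊕,a⁺,c⁺)`, `(𝒜,⊗,a,c)`, a natural left distributivity isomorphism `𝔏` such that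
each `(L^A, 𝔏)` is a `⊕`-functor compatible with `a⁺` and `c⁺` and diagrams (1) and (8) hold. -/
structure IsRingLike (D : Data C) : Prop where
  hPentP : pentP D
  hTriP : triP D
  hHexP : hexP D
  hSymP : symP D
  hPentT : pentT D
  hTriT : triT D
  hHexT1 : hexT1 D
  hHexT2 : hexT2 D
  hSymT : symT D
  hCompLaP : compLaP D
  hCompLcP : compLcP D
  hD1 : diag1 D
  hD8 : diag8 D

/-- The right distributivity constraint is the one induced from `𝔏` and the braiding via
diagram (6): `ℜ_{X,Y,A} = (c_{A,X} ⊕ c_{A,Y}) ∘ 𝔏_{A,X,Y} ∘ c_{A,X⊕Y}⁻¹`. -/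
def drFormula (D : Data C) : Prop := ∀ X Y A : C,
  (D.dr X Y A).hom
    = (D.br A (D.pl.obj X Y)).inv ≫ (D.dl A X Y).hom
      ≫ D.pl.map (D.br A X).hom (D.br A Y).hom

end AnnCat

namespace AnnCat

section

variable {C : Type u} [Category.{v} C]

namespace Bifunc

theorem map_comp_map (F : Bifunc C) {A B E X Y Z : C} (f : A ⟶ B) (g : B ⟶ E)
    (h : X ⟶ Y) (k : Y ⟶ Z) : F.map f h ≫ F.map g k = F.map (f ≫ g) (h ≫ k) :=
  (F.map_comp f g h k).symm

theorem map_comp_map_assoc (F : Bifunc C) {A B E X Y Z W : C} (f : A ⟶ B) (g : B ⟶ E)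
    (h : X ⟶ Y) (k : Y ⟶ Z) (t : F.obj E Z ⟶ W) :
    F.map f h ≫ F.map g k ≫ t = F.map (f ≫ g) (h ≫ k) ≫ t := by
  rw [F.map_comp, Category.assoc]

theorem map_id_comp (F : Bifunc C) (A : C) {X Y Z : C} (h : X ⟶ Y) (k : Y ⟶ Z) :
    F.map (𝟙 A) (h ≫ k) = F.map (𝟙 A) h ≫ F.map (𝟙 A) k := by
  rw [← F.map_comp, Category.comp_id]

/-- The isomorphism induced by a bifunctor from a pair of isomorphisms. -/
@[simps]
def mapIso (F : Bifunc C) {A B X Y : C} (i : A ≅ B) (j : X ≅ Y) : F.obj A X ≅ F.obj B Y where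
  hom := F.map i.hom j.hom
  inv := F.map i.inv j.inv
  hom_inv_id := by rw [← F.map_comp, i.hom_inv_id, j.hom_inv_id, F.map_id]
  inv_hom_id := by rw [← F.map_comp, i.inv_hom_id, j.inv_hom_id, F.map_id]

/-- The monoidal category whose product is a bifunctor, with associativity constraint `α` and
unit constraints `l`, `r`. -/
@[reducible]
def monoidalCategory (F : Bifunc C) (e : C)
    (α : ∀ A B X : C, F.obj A (F.obj B X) ≅ F.obj (F.obj A B) X)
    (l : ∀ A : C, F.obj e A ≅ A) (r : ∀ A : C, F.obj A e ≅ A)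
    (natα : ∀ {A A' B B' X X' : C} (f : A ⟶ A') (h : B ⟶ B') (k : X ⟶ X'),
      F.map f (F.map h k) ≫ (α A' B' X').hom = (α A B X).hom ≫ F.map (F.map f h) k)
    (natl : ∀ {A A' : C} (f : A ⟶ A'), F.map (𝟙 e) f ≫ (l A').hom = (l A).hom ≫ f)
    (natr : ∀ {A A' : C} (f : A ⟶ A'), F.map f (𝟙 e) ≫ (r A').hom = (r A).hom ≫ f)
    (pent : ∀ W X Y Z : C,
      F.map (𝟙 W) (α X Y Z).hom ≫ (α W (F.obj X Y) Z).hom ≫ F.map (α W X Y).hom (𝟙 Z)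
        = (α W X (F.obj Y Z)).hom ≫ (α (F.obj W X) Y Z).hom)
    (tri : ∀ X Y : C, (α X e Y).hom ≫ F.map (r X).hom (𝟙 Y) = F.map (𝟙 X) (l Y).hom) :
    MonoidalCategory C where
  tensorObj := F.obj
  tensorUnit := e
  tensorHom := F.map
  whiskerLeft := fun X _ _ f => F.map (𝟙 X) f
  whiskerRight := fun f X => F.map f (𝟙 X)
  associator := fun A B X => (α A B X).symm
  leftUnitor := l
  rightUnitor := r
  tensorHom_def := fun f g => by
    rw [← F.map_comp, Category.comp_id, Category.id_comp]
  id_tensorHom_id := F.map_id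
  tensorHom_comp_tensorHom := fun f g h k => (F.map_comp f h g k).symm
  whiskerLeft_id := F.map_id
  id_whiskerRight := F.map_id
  associator_naturality := fun {X₁ X₂ X₃ Y₁ Y₂ Y₃} f g h => by
    change F.map (F.map f g) h ≫ (α Y₁ Y₂ Y₃).inv = (α X₁ X₂ X₃).inv ≫ F.map f (F.map g h)
    rw [Iso.comp_inv_eq, Category.assoc, natα, Iso.inv_hom_id_assoc]
  leftUnitor_naturality := natl
  rightUnitor_naturality := natr
  pentagon := fun W X Y Z => by
    have h : F.mapIso (Iso.refl W) (α X Y Z) ≪≫ α W (F.obj X Y) Z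
        ≪≫ F.mapIso (α W X Y) (Iso.refl Z) = α W X (F.obj Y Z) ≪≫ α (F.obj W X) Y Z :=
      Iso.ext (pent W X Y Z)
    simpa using congrArg Iso.inv h
  triangle := fun X Y => by
    change (α X e Y).inv ≫ F.map (𝟙 X) (l Y).hom = F.map (r X).hom (𝟙 Y)
    rw [← tri, Iso.inv_hom_id_assoc]

end Bifunc

namespace Data

/-- The monoidal category `(𝒜, ⊕, a⁺, (0, g, d))`. -/
@[reducible]
def plMonoidal (D : Data C) (hPent : pentP D) (hTri : triP D) : MonoidalCategory C :=
  D.pl.monoidalCategory D.zero D.aP D.g D.d D.natAP D.natG D.natD hPent hTri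

/-- The monoidal category `(𝒜, ⊗, a, (1, l, r))`. -/
@[reducible]
def tnMonoidal (D : Data C) (hPent : pentT D) (hTri : triT D) : MonoidalCategory C :=
  D.tn.monoidalCategory D.one D.a D.l D.r D.natA D.natL D.natR hPent hTri

/-- The symmetric structure `c⁺` on `(𝒜, ⊕, a⁺, (0, g, d))`. -/
@[reducible]
def plBraided (D : Data C) (hPent : pentP D) (hTri : triP D) (hHex : hexP D) (hSym : symP D) :
    @BraidedCategory C _ (D.plMonoidal hPent hTri) :=
  let := D.plMonoidal hPent hTri
  { braiding := D.cP
    braiding_naturality_right := fun _ _ _ f => D.natCP _ f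
    braiding_naturality_left := fun f _ => D.natCP f _
    hexagon_forward := hHex
    hexagon_reverse := fun X Y Z => by
      have hs : ∀ A B : C, (D.cP A B).symm = D.cP B A := fun A B =>
        Iso.ext ((Iso.inv_comp_eq_id _).1 (by simpa using hSym A B)).symm
      have h : (D.aP Z X Y).symm ≪≫ D.cP Z (D.pl.obj X Y) ≪≫ (D.aP X Y Z).symm
          = D.pl.mapIso (D.cP Z X) (Iso.refl Y) ≪≫ (D.aP X Z Y).symm
            ≪≫ D.pl.mapIso (Iso.refl X) (D.cP Z Y) := Iso.ext (hHex Z X Y)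
      change (D.aP X Y Z).hom ≫ (D.cP (D.pl.obj X Y) Z).hom ≫ (D.aP Z X Y).hom
        = D.pl.map (𝟙 X) (D.cP Y Z).hom ≫ (D.aP X Z Y).hom ≫ D.pl.map (D.cP X Z).hom (𝟙 Y)
      simpa [← hs (D.pl.obj X Y) Z, ← hs Y Z, ← hs X Z] using congrArg Iso.inv h }

/-- The braiding `c` on `(𝒜, ⊗, a, (1, l, r))`. -/
@[reducible]
def tnBraided (D : Data C) (hPent : pentT D) (hTri : triT D) (hHex₁ : hexT1 D)
    (hHex₂ : hexT2 D) : @BraidedCategory C _ (D.tnMonoidal hPent hTri) :=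
  let := D.tnMonoidal hPent hTri
  { braiding := D.br
    braiding_naturality_right := fun _ _ _ f => D.natBr _ f
    braiding_naturality_left := fun f _ => D.natBr f _
    hexagon_forward := hHex₁
    hexagon_reverse := hHex₂ }

end Data

theorem brUnit_of_hexT {D : Data C} (hPent : pentT D) (hTri : triT D) (hHex₁ : hexT1 D)
    (hHex₂ : hexT2 D) : brUnit D :=
  let := D.tnMonoidal hPent hTri
  let := D.tnBraided hPent hTri hHex₁ hHex₂
  braiding_rightUnitor

theorem v_natural (D : Data C) {U U' V V' Z Z' T T' : C} (f : U ⟶ U') (h : V ⟶ V')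
    (k : Z ⟶ Z') (m : T ⟶ T') :
    D.pl.map (D.pl.map f h) (D.pl.map k m) ≫ v D U' V' Z' T'
      = v D U V Z T ≫ D.pl.map (D.pl.map f k) (D.pl.map h m) := by
  have natInv : ∀ {A A' B B' X X' : C} (p : A ⟶ A') (q : B ⟶ B') (t : X ⟶ X'),
      D.pl.map (D.pl.map p q) t ≫ (D.aP A' B' X').inv
        = (D.aP A B X).inv ≫ D.pl.map p (D.pl.map q t) := fun p q t => by
    rw [Iso.comp_inv_eq, Category.assoc, D.natAP, Iso.inv_hom_id_assoc]
  simp only [v, Category.assoc, ← D.natAP, reassoc_of% @natInv, Bifunc.map_comp_map_assoc,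
    Category.comp_id, Category.id_comp, ← natInv, reassoc_of% D.natAP, D.natCP]

theorem v_comp_leftUnit {D : Data C} (hPent : pentP D) (hTri : triP D) (hHex : hexP D)
    (hSym : symP D) (X Y : C) :
    v D D.zero X D.zero Y ≫ D.pl.map (D.g D.zero).hom (𝟙 (D.pl.obj X Y))
        ≫ (D.g (D.pl.obj X Y)).hom
      = D.pl.map (D.g X).hom (D.g Y).hom := by
  let := D.plMonoidal hPent hTri
  let := D.plBraided hPent hTri hHex hSym
  refine Eq.trans ?_ (MonoidalCategory.leftUnitor_monoidal X Y).symm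
  simp only [v, MonoidalCategory.tensorμ, Bifunc.map_id_comp, Category.assoc]
  rfl

/-- Adding an object is fully faithful in a categorical group. -/
theorem exists_unique_pl {D : Data C} (hPent : pentP D) (hTri : triP D)
    (hInv : invObjP D) (W : C) {X Y : C} (f : D.pl.obj X W ⟶ D.pl.obj Y W) :
    ∃! k : X ⟶ Y, D.pl.map k (𝟙 W) = f := by
  let := D.plMonoidal hPent hTri
  obtain ⟨W', ⟨i⟩⟩ := hInv W
  have e₁ : MonoidalCategory.tensorRight W ⋙ MonoidalCategory.tensorRight W' ≅ 𝟭 C :=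
    (MonoidalCategory.tensorRightTensor W W').symm
      ≪≫ (MonoidalCategory.tensoringRight C).mapIso i ≪≫ MonoidalCategory.rightUnitorNatIso C
  have e₂ : MonoidalCategory.tensorRight W' ⋙ MonoidalCategory.tensorRight W ≅ 𝟭 C :=
    (MonoidalCategory.tensorRightTensor W' W).symm
      ≪≫ (MonoidalCategory.tensoringRight C).mapIso (D.cP W' W ≪≫ i)
      ≪≫ MonoidalCategory.rightUnitorNatIso C
  have : (MonoidalCategory.tensorRight W).IsEquivalence :=
    (CategoryTheory.Equivalence.mk _ (MonoidalCategory.tensorRight W') e₁.symm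
      e₂).isEquivalence_functor
  obtain ⟨k, hk⟩ := (MonoidalCategory.tensorRight W).map_surjective f
  exact ⟨k, hk, fun m hm => (MonoidalCategory.tensorRight W).map_injective (hm.trans hk.symm)⟩

end

section

variable {C : Type u} [Category.{v} C] {D : Data C}

theorem drFormula_iff_diag6 : drFormula D ↔ diag6 D :=
  ⟨fun h A X Y => (Iso.eq_inv_comp _).1 (h X Y A) |>.symm,
    fun h X Y A => (Iso.eq_inv_comp _).2 (h A X Y).symm⟩

theorem compRcP_of_compLcP (h6 : diag6 D) (hL : compLcP D) : compRcP D := fun X Y A => by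
  rw [← cancel_epi (D.br A (D.pl.obj X Y)).hom, ← reassoc_of% h6 A X Y, D.natCP,
    reassoc_of% hL A X Y, h6, reassoc_of% D.natBr]

theorem compRaP_of_compLaP (h6 : diag6 D) (hL : compLaP D) : compRaP D := fun X Y Z A => by
  rw [← cancel_epi (D.br A (D.pl.obj X (D.pl.obj Y Z))).hom, ← reassoc_of% h6 A,
    ← reassoc_of% D.natBr, ← reassoc_of% h6 A, D.pl.map_comp_map, D.pl.map_comp_map_assoc,
    ← h6, ← h6, Category.comp_id, Category.comp_id, ← Category.id_comp (D.br A X).hom,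
    D.pl.map_comp, Category.assoc, D.natAP, ← reassoc_of% hL A X Y Z, D.pl.map_comp_map]
  simp only [Category.id_comp]

theorem hexT1_of_symT (hSym : symT D) (hHex : hexT1 D) (A B Z : C) :
    D.tn.map (𝟙 A) (D.br B Z).hom ≫ (D.a A Z B).hom
      = (D.a A B Z).hom ≫ D.tn.map (D.br A B).hom (𝟙 Z) ≫ (D.a B A Z).inv
        ≫ (D.br B (D.tn.obj A Z)).hom := by
  rw [← cancel_mono (D.a A Z B).inv]
  simp only [Category.assoc, Iso.hom_inv_id, Category.comp_id, hHex B A Z,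
    D.tn.map_comp_map_assoc, hSym A B, D.tn.map_id, Category.id_comp, Iso.hom_inv_id_assoc]

theorem diag3_of_diag1 (hSym : symT D) (hHex : hexT1 D) (h6 : diag6 D) (h1 : diag1 D) :
    diag3 D := fun A X Y B => by
  have h1' : (D.a B A (D.pl.obj X Y)).inv ≫ D.tn.map (𝟙 B) (D.dl A X Y).hom
        ≫ (D.dl B (D.tn.obj A X) (D.tn.obj A Y)).hom
      = (D.dl (D.tn.obj B A) X Y).hom ≫ D.pl.map (D.a B A X).inv (D.a B A Y).inv := by
    rw [Iso.inv_comp_eq, reassoc_of% h1 B A X Y, D.pl.map_comp_map, Iso.hom_inv_id,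
      Iso.hom_inv_id, D.pl.map_id, Category.comp_id]
  have := (D.tn.mapIso (Iso.refl A) (D.br B (D.pl.obj X Y))).isIso_hom
  rw [← cancel_epi (D.tn.mapIso (Iso.refl A) (D.br B (D.pl.obj X Y))).hom]
  simp only [Bifunc.mapIso_hom, Iso.refl_hom]
  calc
    _ = (D.a A B (D.pl.obj X Y)).hom ≫ D.tn.map (D.br A B).hom (𝟙 _)
          ≫ (D.a B A (D.pl.obj X Y)).inv ≫ D.tn.map (𝟙 B) (D.dl A X Y).hom
          ≫ (D.dl B (D.tn.obj A X) (D.tn.obj A Y)).hom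
          ≫ D.pl.map (D.br B (D.tn.obj A X)).hom (D.br B (D.tn.obj A Y)).hom := by
      rw [reassoc_of% hexT1_of_symT hSym hHex, ← reassoc_of% D.natBr, h6]
    _ = (D.a A B (D.pl.obj X Y)).hom ≫ (D.dl (D.tn.obj A B) X Y).hom
          ≫ D.pl.map (D.tn.map (D.br A B).hom (𝟙 X) ≫ (D.a B A X).inv
              ≫ (D.br B (D.tn.obj A X)).hom)
            (D.tn.map (D.br A B).hom (𝟙 Y) ≫ (D.a B A Y).inv
              ≫ (D.br B (D.tn.obj A Y)).hom) := by
      rw [reassoc_of% h1', ← D.pl.map_id, reassoc_of% D.natDL, D.pl.map_comp_map,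
        D.pl.map_comp_map]
    _ = D.tn.map (𝟙 A) (D.dl B X Y).hom ≫ (D.dl A (D.tn.obj B X) (D.tn.obj B Y)).hom
          ≫ D.pl.map (D.tn.map (𝟙 A) (D.br B X).hom ≫ (D.a A X B).hom)
            (D.tn.map (𝟙 A) (D.br B Y).hom ≫ (D.a A Y B).hom) := by
      rw [reassoc_of% h1 A B X Y, D.pl.map_comp_map, hexT1_of_symT hSym hHex,
        hexT1_of_symT hSym hHex]
    _ = _ := by
      rw [D.pl.map_comp, ← reassoc_of% D.natDL, D.tn.map_comp_map_assoc,
        D.tn.map_comp_map_assoc, h6]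

theorem diag2_of_diag3 (hHex : hexT2 D) (h6 : diag6 D) (h1 : diag1 D) (h3 : diag3 D) :
    diag2 D := fun X Y B A => by
  rw [← cancel_epi (D.br (D.tn.obj B A) (D.pl.obj X Y)).hom,
    ← cancel_epi (D.a B A (D.pl.obj X Y)).hom]
  calc
    _ = D.tn.map (𝟙 B) (D.br A (D.pl.obj X Y)).hom ≫ (D.a B (D.pl.obj X Y) A).hom
          ≫ D.tn.map (D.dl B X Y).hom (𝟙 A) ≫ (D.dr (D.tn.obj B X) (D.tn.obj B Y) A).hom
          ≫ D.pl.map (D.tn.map (D.br B X).hom (𝟙 A)) (D.tn.map (D.br B Y).hom (𝟙 A)) := by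
      rw [← D.natDR, reassoc_of% hHex B A (D.pl.obj X Y), D.tn.map_comp_map_assoc,
        D.tn.map_comp_map_assoc, h6]
    _ = D.tn.map (𝟙 B) (D.dl A X Y).hom ≫ (D.dl B (D.tn.obj A X) (D.tn.obj A Y)).hom
          ≫ D.pl.map (D.tn.map (𝟙 B) (D.br A X).hom ≫ (D.a B X A).hom
              ≫ D.tn.map (D.br B X).hom (𝟙 A))
            (D.tn.map (𝟙 B) (D.br A Y).hom ≫ (D.a B Y A).hom
              ≫ D.tn.map (D.br B Y).hom (𝟙 A)) := by
      rw [reassoc_of% h3 B X Y A, D.pl.map_comp, D.pl.map_comp, ← reassoc_of% D.natDL,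
        D.tn.map_comp_map_assoc, D.tn.map_comp_map_assoc, h6]
    _ = _ := by
      rw [← hHex, ← hHex, D.pl.map_comp, ← reassoc_of% h1 B A X Y, D.pl.map_comp,
        reassoc_of% h6]

theorem diag8_iff_diag4 (hSym : symT D) (h6 : diag6 D) : diag8 D ↔ diag4 D := by
  have hdr : ∀ X Y A : C, (D.br (D.pl.obj X Y) A).hom ≫ (D.dl A X Y).hom
      ≫ D.pl.map (D.br A X).hom (D.br A Y).hom = (D.dr X Y A).hom := fun X Y A => by
    rw [h6, reassoc_of% hSym]
  have hl : ∀ A B X Y : C, (D.dl (D.pl.obj X Y) A B).hom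
      ≫ D.pl.map (D.br (D.pl.obj X Y) A).hom (D.br (D.pl.obj X Y) B).hom
      ≫ D.pl.map (D.dl A X Y).hom (D.dl B X Y).hom
      ≫ v D (D.tn.obj A X) (D.tn.obj A Y) (D.tn.obj B X) (D.tn.obj B Y)
      ≫ D.pl.map (D.pl.map (D.br A X).hom (D.br B X).hom)
          (D.pl.map (D.br A Y).hom (D.br B Y).hom)
      = (D.dl (D.pl.obj X Y) A B).hom ≫ D.pl.map (D.dr X Y A).hom (D.dr X Y B).hom
        ≫ v D (D.tn.obj X A) (D.tn.obj Y A) (D.tn.obj X B) (D.tn.obj Y B) :=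
    fun A B X Y => by
      rw [← v_natural, D.pl.map_comp_map_assoc, D.pl.map_comp_map_assoc, Category.assoc,
        Category.assoc, hdr, hdr]
  have hr : ∀ A B X Y : C, (D.br (D.pl.obj X Y) (D.pl.obj A B)).hom
      ≫ (D.dl (D.pl.obj A B) X Y).hom
      ≫ D.pl.map (D.br (D.pl.obj A B) X).hom (D.br (D.pl.obj A B) Y).hom
      ≫ D.pl.map (D.dl X A B).hom (D.dl Y A B).hom
      = (D.dr X Y (D.pl.obj A B)).hom ≫ D.pl.map (D.dl X A B).hom (D.dl Y A B).hom :=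
    fun A B X Y => by rw [← hdr X Y (D.pl.obj A B)]; simp only [Category.assoc]
  constructor
  · intro h A B X Y
    rw [← hl, ← hr, h]
  · intro h A B X Y
    rw [hl, hr, h]

theorem diag51_of_diag1 (hTri : triT D) (h1 : diag1 D) : diag51 D := fun X Y => by
  have key : D.tn.map (𝟙 D.one) ((D.dl D.one X Y).hom ≫ D.pl.map (D.l X).hom (D.l Y).hom)
      = D.tn.map (𝟙 D.one) (D.l (D.pl.obj X Y)).hom := by
    rw [← cancel_mono (D.dl D.one X Y).hom, D.tn.map_id_comp, Category.assoc, D.natDL,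
      ← hTri, ← hTri, ← hTri, D.pl.map_comp, ← reassoc_of% h1, ← D.natDL, D.pl.map_id,
      Category.assoc]
  have nat := D.natL ((D.dl D.one X Y).hom ≫ D.pl.map (D.l X).hom (D.l Y).hom)
  rw [key, D.natL] at nat
  exact ((cancel_epi _).1 nat).symm

theorem diag52_of_diag51 (h6 : diag6 D) (hU : brUnit D) (h51 : diag51 D) : diag52 D :=
  fun X Y => by
    rw [← cancel_epi (D.br D.one (D.pl.obj X Y)).hom, ← reassoc_of% h6, D.pl.map_comp_map,
      hU, hU, hU, h51]

/-- In a categorical group, `c_{0,0}` is the identity: the constraint `0 ⊗ 0 ⟶ 0` of the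
`⊕`-functor `- ⊗ 0` is also the constraint of `0 ⊗ -`, and `c_{0,0}` exchanges the two. -/
theorem c00_of_diag4 (hPent : pentP D) (hTri : triP D) (hHex : hexP D) (hSym : symP D)
    (hInv : invObjP D) (hGrpd : grpdP C) (h6 : diag6 D) (h4 : diag4 D) : c00 D := by
  have := hGrpd (D.tn.map (𝟙 D.zero) (D.g D.zero).hom)
  have uniq : ∀ {W X Y : C} {k m : X ⟶ Y}, D.pl.map k (𝟙 W) = D.pl.map m (𝟙 W) → k = m :=
    fun h => (exists_unique_pl hPent hTri hInv _ _).unique h rfl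
  obtain ⟨k, hk'⟩ := (exists_unique_pl hPent hTri hInv (D.tn.obj D.zero D.zero)
    ((D.dr D.zero D.zero D.zero).inv ≫ D.tn.map (D.g D.zero).hom (𝟙 D.zero)
      ≫ (D.g _).inv)).exists
  have hk : (D.dr D.zero D.zero D.zero).hom ≫ D.pl.map k (𝟙 _) ≫ (D.g _).hom
      = D.tn.map (D.g D.zero).hom (𝟙 D.zero) := by simp [hk']
  have uniqR : ∀ {A : C} {p q : D.tn.obj D.zero A ⟶ D.zero},
      (D.dr D.zero D.zero A).hom ≫ D.pl.map p (𝟙 _) ≫ (D.g _).hom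
        = D.tn.map (D.g D.zero).hom (𝟙 A) →
      (D.dr D.zero D.zero A).hom ≫ D.pl.map q (𝟙 _) ≫ (D.g _).hom
        = D.tn.map (D.g D.zero).hom (𝟙 A) → p = q := fun hp hq => by
    have h := hp.trans hq.symm
    rw [cancel_epi, cancel_mono] at h
    exact uniq h
  have := hGrpd k
  have natural : (D.dr D.zero D.zero _).hom
        ≫ D.pl.map (D.tn.map (𝟙 D.zero) (D.g D.zero).hom ≫ k) (𝟙 _) ≫ (D.g _).hom
      = D.tn.map (D.g D.zero).hom (𝟙 (D.pl.obj D.zero D.zero)) := by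
    rw [← cancel_mono (D.tn.map (𝟙 D.zero) (D.g D.zero).hom)]
    calc
      _ = (D.dr D.zero D.zero _).hom
            ≫ D.pl.map (D.tn.map (𝟙 D.zero) (D.g D.zero).hom)
              (D.tn.map (𝟙 D.zero) (D.g D.zero).hom)
            ≫ D.pl.map k (𝟙 _) ≫ (D.g _).hom := by
        simp only [Category.assoc, ← D.natG, D.pl.map_comp_map_assoc, Category.comp_id,
          Category.id_comp]
      _ = _ := by
        rw [← reassoc_of% D.natDR, hk, D.pl.map_id, D.tn.map_comp_map, D.tn.map_comp_map]
        simp only [Category.comp_id, Category.id_comp]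
  have additive : (D.dr D.zero D.zero _).hom
        ≫ D.pl.map ((D.dl D.zero D.zero D.zero).hom ≫ D.pl.map k k ≫ (D.g D.zero).hom) (𝟙 _)
        ≫ (D.g _).hom
      = D.tn.map (D.g D.zero).hom (𝟙 (D.pl.obj D.zero D.zero)) := by
    rw [← cancel_mono (D.dl D.zero D.zero D.zero).hom]
    calc
      _ = (D.dr D.zero D.zero _).hom
            ≫ D.pl.map (D.dl D.zero D.zero D.zero).hom (D.dl D.zero D.zero D.zero).hom
            ≫ D.pl.map (D.pl.map k k) (D.pl.map (𝟙 _) (𝟙 _))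
            ≫ D.pl.map (D.g D.zero).hom (𝟙 _) ≫ (D.g _).hom := by
        simp only [Category.assoc, ← D.natG, D.pl.map_comp_map_assoc, Category.comp_id,
          Category.id_comp, D.pl.map_id]
      _ = (D.dl (D.pl.obj D.zero D.zero) D.zero D.zero).hom
            ≫ D.pl.map ((D.dr D.zero D.zero D.zero).hom ≫ D.pl.map k (𝟙 _) ≫ (D.g _).hom)
              ((D.dr D.zero D.zero D.zero).hom ≫ D.pl.map k (𝟙 _) ≫ (D.g _).hom) := by
        rw [← reassoc_of% h4, ← reassoc_of% v_natural,
          v_comp_leftUnit hPent hTri hHex hSym, D.pl.map_comp_map, D.pl.map_comp_map]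
      _ = _ := by
        rw [hk, ← D.natDL, D.pl.map_id]
  have left₁ : (D.dl D.zero D.zero D.zero).hom ≫ D.pl.map k (𝟙 _) ≫ (D.g _).hom
      = D.tn.map (𝟙 D.zero) (D.g D.zero).hom := by
    rw [← cancel_mono k, uniqR natural additive, Category.assoc, Category.assoc, ← D.natG,
      D.pl.map_comp_map_assoc, Category.comp_id, Category.id_comp]
  have left₂ : (D.dl D.zero D.zero D.zero).hom
        ≫ D.pl.map ((D.br D.zero D.zero).hom ≫ k) (𝟙 _) ≫ (D.g _).hom
      = D.tn.map (𝟙 D.zero) (D.g D.zero).hom := by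
    rw [← cancel_mono (D.br D.zero D.zero).hom, D.natBr, ← hk, ← reassoc_of% h6,
      Category.assoc, Category.assoc, ← D.natG, D.pl.map_comp_map_assoc,
      D.pl.map_comp_map_assoc, Category.comp_id, Category.id_comp, Category.comp_id]
  have h : (D.br D.zero D.zero).hom ≫ k = 𝟙 _ ≫ k := by
    rw [Category.id_comp]
    have h := left₂.trans left₁.symm
    rw [cancel_epi, cancel_mono] at h
    exact uniq h
  exact (cancel_mono k).1 h

end

/-- **Proposition 6.2.** A category with the data of bifunctors `⊕`, `⊗` and constraint
isomorphisms is a symmetric Ann-category iff (i) it is a ring-like category and (ii) all objects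
are `⊕`-invertible and the underlying category of `(𝒜, ⊕)` is a groupoid; in the `if`
direction the right distributivity constraint is given by
`ℜ_{X,Y,A} = (c_{A,X} ⊕ c_{A,Y}) ∘ 𝔏_{A,X,Y} ∘ c_{A,X⊕Y}⁻¹`. -/
theorem stmt10 {C : Type u} [Category.{v} C] (D : Data C) :
    IsSymAnn D ↔ (IsRingLike D ∧ invObjP D ∧ grpdP C ∧ drFormula D) := by
  constructor
  · rintro ⟨h, hSym⟩
    exact
      ⟨{ hPentP := h.hPentP
         hTriP := h.hTriP
         hHexP := h.hHexP
         hSymP := h.hSymP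
         hPentT := h.hPentT
         hTriT := h.hTriT
         hHexT1 := h.hHex1
         hHexT2 := h.hHex2
         hSymT := hSym
         hCompLaP := h.hCompLaP
         hCompLcP := h.hCompLcP
         hD1 := h.hD1
         hD8 := (diag8_iff_diag4 hSym h.hD6).2 h.hD4 },
        h.hInv, h.hGrpd, drFormula_iff_diag6.2 h.hD6⟩
  · rintro ⟨h, hInv, hGrpd, hdr⟩
    have h6 : diag6 D := drFormula_iff_diag6.1 hdr
    have h3 : diag3 D := diag3_of_diag1 h.hSymT h.hHexT1 h6 h.hD1
    have h4 : diag4 D := (diag8_iff_diag4 h.hSymT h6).1 h.hD8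
    have h51 : diag51 D := diag51_of_diag1 h.hTriT h.hD1
    exact
      ⟨{ hPentP := h.hPentP
         hTriP := h.hTriP
         hHexP := h.hHexP
         hSymP := h.hSymP
         hGrpd := hGrpd
         hInv := hInv
         hPentT := h.hPentT
         hTriT := h.hTriT
         hCompLaP := h.hCompLaP
         hCompLcP := h.hCompLcP
         hCompRaP := compRaP_of_compLaP h6 h.hCompLaP
         hCompRcP := compRcP_of_compLcP h6 h.hCompLcP
         hD1 := h.hD1
         hD2 := diag2_of_diag3 h.hHexT2 h6 h.hD1 h3
         hD3 := h3
         hD4 := h4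
         hD51 := h51
         hD52 := diag52_of_diag51 h6
           (brUnit_of_hexT h.hPentT h.hTriT h.hHexT1 h.hHexT2) h51
         hHex1 := h.hHexT1
         hHex2 := h.hHexT2
         hD6 := h6
         hC00 := c00_of_diag4 h.hPentP h.hTriP h.hHexP h.hSymP hInv hGrpd h6 h4 },
        h.hSymT⟩

end AnnCat
end

section
/- Let 𝒜 be a category with two bifunctors ⊕, ⊗ : 𝒜 × 𝒜 → 𝒜. Then 𝒜 is a symmetric Ann-category if and only if the following conditions are satisfied: (i) there are an object 0 and natural isomorphisms a⁺, c⁺, g, d such that (𝒜,⊕,a⁺,c⁺,(0,g,d)) is a symmetric categorical group; (ii) there are an object 1 and natural isomorphisms a, c, l, r such that (𝒜,⊗,a,c,(1,l,r)) is a symmetric monoidal category; (iii) there is a natural isomorphism 𝔏_{A,X,Y} : A⊗(X⊕Y) → (A⊗X)⊕(A⊗Y) such that each (L^A = A⊗−, 𝔏_{A,−,−}) is an ⊕-functor compatible with a⁺ and c⁺ and the diagrams (1), (8) and (5.1) commute. In the 'if' direction the right distributivity constraint is defined by ℜ_{X,Y,A} := (c_{A,X}⊕c_{A,Y})∘𝔏_{A,X,Y}∘c_{A,X⊕Y}^{-1}.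 -/
open CategoryTheory

universe v u

namespace AnnCat


namespace Bifunc

variable {C : Type u} [Category.{v} C] (T : Bifunc C)

theorem comp_map {A B E X Y Z : C} (f : A ⟶ B) (g : B ⟶ E) (h : X ⟶ Y) (k : Y ⟶ Z) :
    T.map f h ≫ T.map g k = T.map (f ≫ g) (h ≫ k) :=
  (T.map_comp f g h k).symm

theorem comp_map_assoc {A B E X Y Z W : C} (f : A ⟶ B) (g : B ⟶ E) (h : X ⟶ Y) (k : Y ⟶ Z)
    (m : T.obj E Z ⟶ W) : T.map f h ≫ T.map g k ≫ m = T.map (f ≫ g) (h ≫ k) ≫ m := by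
  rw [T.map_comp, Category.assoc]

theorem id_map_comp (A : C) {X Y Z : C} (f : X ⟶ Y) (g : Y ⟶ Z) :
    T.map (𝟙 A) (f ≫ g) = T.map (𝟙 A) f ≫ T.map (𝟙 A) g := by
  rw [comp_map, Category.id_comp]

theorem comp_map_id (A : C) {X Y Z : C} (f : X ⟶ Y) (g : Y ⟶ Z) :
    T.map (f ≫ g) (𝟙 A) = T.map f (𝟙 A) ≫ T.map g (𝟙 A) := by
  rw [comp_map, Category.id_comp]

instance isIso_map {A B X Y : C} (f : A ⟶ B) (h : X ⟶ Y) [IsIso f] [IsIso h] :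
    IsIso (T.map f h) :=
  ⟨T.map (inv f) (inv h), by simp [comp_map, map_id], by simp [comp_map, map_id]⟩

/-- The coherence facts about units in a braided monoidal category. -/
theorem unit_coherence (e : C)
    (a : ∀ A B X : C, T.obj A (T.obj B X) ≅ T.obj (T.obj A B) X)
    (l : ∀ A : C, T.obj e A ≅ A) (r : ∀ A : C, T.obj A e ≅ A)
    (c : ∀ A B : C, T.obj A B ≅ T.obj B A)
    (natA : ∀ {A A' B B' X X' : C} (f : A ⟶ A') (h : B ⟶ B') (k : X ⟶ X'),
      T.map f (T.map h k) ≫ (a A' B' X').hom = (a A B X).hom ≫ T.map (T.map f h) k)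
    (natL : ∀ {A A' : C} (f : A ⟶ A'), T.map (𝟙 e) f ≫ (l A').hom = (l A).hom ≫ f)
    (natR : ∀ {A A' : C} (f : A ⟶ A'), T.map f (𝟙 e) ≫ (r A').hom = (r A).hom ≫ f)
    (natC : ∀ {A A' B B' : C} (f : A ⟶ A') (h : B ⟶ B'),
      T.map f h ≫ (c A' B').hom = (c A B).hom ≫ T.map h f)
    (pent : ∀ W X Y Z : C,
      T.map (𝟙 W) (a X Y Z).hom ≫ (a W (T.obj X Y) Z).hom ≫ T.map (a W X Y).hom (𝟙 Z)
        = (a W X (T.obj Y Z)).hom ≫ (a (T.obj W X) Y Z).hom)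
    (tri : ∀ X Y : C, (a X e Y).hom ≫ T.map (r X).hom (𝟙 Y) = T.map (𝟙 X) (l Y).hom)
    (hex : ∀ X Y Z : C,
      (a X Y Z).inv ≫ (c X (T.obj Y Z)).hom ≫ (a Y Z X).inv
        = T.map (c X Y).hom (𝟙 Z) ≫ (a Y X Z).inv ≫ T.map (𝟙 Y) (c X Z).hom)
    (sym : ∀ A B : C, (c A B).hom ≫ (c B A).hom = 𝟙 (T.obj A B)) :
    (∀ A : C, (c e A).hom ≫ (r A).hom = (l A).hom) ∧ (l e).hom = (r e).hom := by
  let _ : MonoidalCategoryStruct C :=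
    { tensorObj := T.obj
      whiskerLeft := fun X _ _ f => T.map (𝟙 X) f
      whiskerRight := fun f X => T.map f (𝟙 X)
      tensorHom := fun f h => T.map f h
      tensorUnit := e
      associator := fun A B X => (a A B X).symm
      leftUnitor := l
      rightUnitor := r }
  let _ : MonoidalCategory C := MonoidalCategory.ofTensorHom
    (id_tensorHom_id := T.map_id)
    (id_tensorHom := fun _ _ _ _ => rfl)
    (tensorHom_id := fun _ _ => rfl)
    (tensorHom_comp_tensorHom := fun f₁ f₂ g₁ g₂ => T.comp_map f₁ g₁ f₂ g₂)
    (associator_naturality := fun f₁ f₂ f₃ => by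
      change T.map (T.map f₁ f₂) f₃ ≫ (a _ _ _).inv = (a _ _ _).inv ≫ T.map f₁ (T.map f₂ f₃)
      rw [Iso.eq_inv_comp, ← Category.assoc, Iso.comp_inv_eq, natA])
    (leftUnitor_naturality := natL)
    (rightUnitor_naturality := natR)
    (pentagon := fun W X Y Z => by
      change T.map (a W X Y).inv (𝟙 Z) ≫ (a W (T.obj X Y) Z).inv ≫ T.map (𝟙 W) (a X Y Z).inv
        = (a (T.obj W X) Y Z).inv ≫ (a W X (T.obj Y Z)).inv
      rw [← cancel_epi (T.map (𝟙 W) (a X Y Z).hom ≫ (a W (T.obj X Y) Z).hom ≫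
        T.map (a W X Y).hom (𝟙 Z))]
      conv_rhs => rw [pent]
      simp [comp_map, comp_map_assoc, map_id])
    (triangle := fun X Y => by
      change (a X e Y).inv ≫ T.map (𝟙 X) (l Y).hom = T.map (r X).hom (𝟙 Y)
      rw [← tri, Iso.inv_hom_id_assoc])
  let _ : BraidedCategory C :=
    { braiding := c
      braiding_naturality_right := fun X _ _ f => natC (𝟙 X) f
      braiding_naturality_left := fun f Z => natC f (𝟙 Z)
      hexagon_forward := hex
      hexagon_reverse := fun X Y Z => by
        change (a X Y Z).hom ≫ (c (T.obj X Y) Z).hom ≫ (a Z X Y).hom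
          = T.map (𝟙 X) (c Y Z).hom ≫ (a X Z Y).hom ≫ T.map (c X Z).hom (𝟙 Y)
        rw [← cancel_mono ((a Z X Y).inv ≫ (c Z (T.obj X Y)).hom ≫ (a X Y Z).inv)]
        conv_rhs => rw [hex]
        simp only [Category.assoc, Iso.hom_inv_id_assoc, comp_map_assoc, sym, Category.id_comp,
          map_id, reassoc_of% (sym _ _), Iso.hom_inv_id, comp_map] }
  exact ⟨fun A => braiding_rightUnitor A, MonoidalCategory.unitors_equal⟩

end Bifunc

namespace Data

variable {C : Type u} [Category.{v} C] (D : Data C)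

/-- The middle four interchange is natural. -/
theorem v_natural {U V Z T U' V' Z' T' : C} (f : U ⟶ U') (h : V ⟶ V') (k : Z ⟶ Z')
    (m : T ⟶ T') :
    D.pl.map (D.pl.map f h) (D.pl.map k m) ≫ v D U' V' Z' T'
      = v D U V Z T ≫ D.pl.map (D.pl.map f k) (D.pl.map h m) := by
  have natInv {A A' B B' X X' : C} (f : A ⟶ A') (h : B ⟶ B') (k : X ⟶ X') :
      D.pl.map (D.pl.map f h) k ≫ (D.aP A' B' X').inv
        = (D.aP A B X).inv ≫ D.pl.map f (D.pl.map h k) := by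
    rw [Iso.eq_inv_comp, ← Category.assoc, Iso.comp_inv_eq, D.natAP]
  simp only [v, Category.assoc, reassoc_of% (natInv f h (D.pl.map k m)), ← D.natAP,
    Bifunc.comp_map_assoc, Category.id_comp, Category.comp_id]
  rw [reassoc_of% (D.natAP h k m), Bifunc.comp_map_assoc, D.natCP, ← natInv, Bifunc.comp_map_assoc,
    Category.comp_id, Category.id_comp]

variable {D}

theorem br_inv (hS : symT D) (A B : C) : (D.br A B).inv = (D.br B A).hom := by
  rw [← cancel_epi (D.br A B).hom, Iso.hom_inv_id, hS]

theorem dr_eq (hS : symT D) (hR : drFormula D) (X Y A : C) : (D.dr X Y A).hom =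
    (D.br (D.pl.obj X Y) A).hom ≫ (D.dl A X Y).hom ≫
      D.pl.map (D.br A X).hom (D.br A Y).hom := by
  rw [hR, br_inv hS]

theorem diag8_iff_diag4 (hS : symT D) (hR : drFormula D) : diag8 D ↔ diag4 D := by
  have key (A B X Y : C) : (D.dl (D.pl.obj X Y) A B).hom
      ≫ D.pl.map (D.br (D.pl.obj X Y) A).hom (D.br (D.pl.obj X Y) B).hom
      ≫ D.pl.map (D.dl A X Y).hom (D.dl B X Y).hom
      ≫ v D (D.tn.obj A X) (D.tn.obj A Y) (D.tn.obj B X) (D.tn.obj B Y)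
      ≫ D.pl.map (D.pl.map (D.br A X).hom (D.br B X).hom)
          (D.pl.map (D.br A Y).hom (D.br B Y).hom)
      = (D.dl (D.pl.obj X Y) A B).hom ≫ D.pl.map (D.dr X Y A).hom (D.dr X Y B).hom
        ≫ v D (D.tn.obj X A) (D.tn.obj Y A) (D.tn.obj X B) (D.tn.obj Y B) := by
    rw [← v_natural]
    simp only [Bifunc.comp_map_assoc, ← dr_eq hS hR]
  have key' (A B X Y : C) :
      (D.br (D.pl.obj X Y) (D.pl.obj A B)).hom ≫ (D.dl (D.pl.obj A B) X Y).hom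
      ≫ D.pl.map (D.br (D.pl.obj A B) X).hom (D.br (D.pl.obj A B) Y).hom
      ≫ D.pl.map (D.dl X A B).hom (D.dl Y A B).hom
      = (D.dr X Y (D.pl.obj A B)).hom ≫ D.pl.map (D.dl X A B).hom (D.dl Y A B).hom := by
    simp only [dr_eq hS hR, Category.assoc]
  constructor
  · intro h A B X Y
    rw [← key, ← key', h]
  · intro h A B X Y
    rw [key, key', h]

theorem diag6_iff_drFormula : diag6 D ↔ drFormula D := by
  unfold diag6 drFormula
  constructor
  · intro h X Y A
    rw [h, Iso.inv_hom_id_assoc]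
  · intro h A X Y
    rw [h, Iso.hom_inv_id_assoc]

theorem compRaP_of_drFormula (hR : drFormula D) (h : compLaP D) : compRaP D := by
  intro X Y Z A
  have h6 (X Y : C) := diag6_iff_drFormula.2 hR A X Y
  rw [← cancel_epi (D.br A _).hom, ← reassoc_of% (D.natBr (𝟙 A) (D.aP X Y Z).hom),
    ← reassoc_of% (h6 (D.pl.obj X Y) Z), ← reassoc_of% (h6 X (D.pl.obj Y Z)),
    Bifunc.comp_map, Bifunc.comp_map_assoc, Category.comp_id, Category.comp_id, ← h6, ← h6,
    ← Category.id_comp (D.br A Z).hom, ← Bifunc.comp_map, reassoc_of% (h A X Y Z), Category.id_comp,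
    ← D.natAP, Bifunc.comp_map_assoc, Category.id_comp]

theorem compRcP_of_drFormula (hR : drFormula D) (h : compLcP D) : compRcP D := by
  intro X Y A
  rw [← cancel_epi (D.br A _).hom, ← reassoc_of% (D.natBr (𝟙 A) (D.cP X Y).hom)]
  simp only [hR _ _ _, Category.assoc, Iso.hom_inv_id_assoc, D.natCP, ← reassoc_of% (h _ _ _)]

theorem map_dl_comp_dl (h : diag1 D) (A B X Y : C) :
    D.tn.map (𝟙 A) (D.dl B X Y).hom ≫ (D.dl A (D.tn.obj B X) (D.tn.obj B Y)).hom
      = (D.a A B (D.pl.obj X Y)).hom ≫ (D.dl (D.tn.obj A B) X Y).hom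
        ≫ D.pl.map (D.a A B X).inv (D.a A B Y).inv := by
  rw [reassoc_of% (h A B X Y)]
  simp [Bifunc.comp_map, Bifunc.map_id]

theorem diag3_of_diag1 (hS : symT D) (hR : drFormula D) (hH1 : hexT1 D) (hH2 : hexT2 D)
    (h : diag1 D) : diag3 D := by
  intro A X Y B
  have hex (Z : C) :
      D.tn.map (D.br A B).hom (𝟙 Z) ≫ (D.a B A Z).inv ≫ (D.br B (D.tn.obj A Z)).hom
        = (D.a A B Z).inv ≫ D.tn.map (𝟙 A) (D.br B Z).hom ≫ (D.a A Z B).hom := by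
    rw [← cancel_mono (D.a A Z B).inv]
    simp only [Category.assoc, hH1 B A Z, Iso.hom_inv_id, Category.comp_id]
    rw [Bifunc.comp_map_assoc, hS, Category.id_comp, Bifunc.map_id, Category.id_comp]
  have natBrDL := D.natDL (D.br A B).hom (𝟙 X) (𝟙 Y)
  rw [Bifunc.map_id] at natBrDL
  have natDLBr := D.natDL (𝟙 A) (D.br B X).hom (D.br B Y).hom
  rw [dr_eq hS hR, dr_eq hS hR, reassoc_of% (D.natBr (D.dl A X Y).hom (𝟙 B)),
    reassoc_of% (map_dl_comp_dl h B A X Y), reassoc_of% (hH2 A (D.pl.obj X Y) B),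
    reassoc_of% natBrDL, Bifunc.id_map_comp, Bifunc.id_map_comp, Category.assoc, Category.assoc,
    reassoc_of% natDLBr, reassoc_of% (map_dl_comp_dl h A B X Y)]
  simp only [Bifunc.comp_map, hex]

theorem diag2_of_diag1 (hS : symT D) (hR : drFormula D) (hH1 : hexT1 D) (hH2 : hexT2 D)
    (h : diag1 D) : diag2 D := by
  intro X Y B A
  have h3 : D.tn.map (D.dl B X Y).hom (𝟙 A) ≫ (D.dr (D.tn.obj B X) (D.tn.obj B Y) A).hom
      = (D.a B (D.pl.obj X Y) A).inv ≫ D.tn.map (𝟙 B) (D.dr X Y A).hom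
        ≫ (D.dl B (D.tn.obj X A) (D.tn.obj Y A)).hom
        ≫ D.pl.map (D.a B X A).hom (D.a B Y A).hom := by
    rw [← diag3_of_diag1 hS hR hH1 hH2 h, Iso.inv_hom_id_assoc]
  have hex (Z : C) : (D.a B A Z).inv ≫ D.tn.map (𝟙 B) (D.br A Z).hom ≫ (D.a B Z A).hom
      ≫ D.tn.map (D.br B Z).hom (𝟙 A) = (D.br (D.tn.obj B A) Z).hom ≫ (D.a Z B A).hom := by
    rw [← hH2, Iso.inv_hom_id_assoc]
  have natDLBr := D.natDL (𝟙 B) (D.br A X).hom (D.br A Y).hom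
  have hex' : D.tn.map (D.br (D.pl.obj X Y) B).hom (𝟙 A) ≫ (D.a B (D.pl.obj X Y) A).inv
      ≫ D.tn.map (𝟙 B) (D.br (D.pl.obj X Y) A).hom ≫ (D.a B A (D.pl.obj X Y)).hom
      = (D.a (D.pl.obj X Y) B A).inv ≫ (D.br (D.pl.obj X Y) (D.tn.obj B A)).hom := by
    have := hH1 (D.pl.obj X Y) B A
    rw [← cancel_mono (D.a B A (D.pl.obj X Y)).inv]
    simp only [Category.assoc, Iso.hom_inv_id, Category.comp_id, this]
  rw [dr_eq hS hR X Y B, Bifunc.comp_map_id, Bifunc.comp_map_id, Category.assoc, Category.assoc,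
    D.natDR, reassoc_of% h3, dr_eq hS hR X Y A, Bifunc.id_map_comp, Bifunc.id_map_comp,
    Category.assoc, Category.assoc, reassoc_of% natDLBr, reassoc_of% (map_dl_comp_dl h B A X Y),
    reassoc_of% hex', Iso.hom_inv_id_assoc, dr_eq hS hR]
  simp only [Bifunc.comp_map, Category.assoc, hex]

theorem diag52_of_diag51 (hS : symT D) (hR : drFormula D) (hU : brUnit D) (h : diag51 D) :
    diag52 D := by
  intro X Y
  rw [dr_eq hS hR]
  simp only [Category.assoc, Bifunc.comp_map, hU _, h _ _]
  rw [← hU, reassoc_of% (hS _ _)]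

/-- The functor `- ⊕ A`. -/
def addRight (D : Data C) (A : C) : C ⥤ C where
  obj X := D.pl.obj X A
  map f := D.pl.map f (𝟙 A)
  map_id X := D.pl.map_id X A
  map_comp f h := D.pl.comp_map_id A f h

/-- If `A ⊕ B ≅ 0` then `(- ⊕ A) ⊕ B` is isomorphic to the identity. -/
noncomputable def addRightCompIso (D : Data C) {A B : C} (e : D.pl.obj A B ≅ D.zero) :
    D.addRight A ⋙ D.addRight B ≅ 𝟭 C :=
  NatIso.ofComponents
    (fun X => (D.aP X A B).symm ≪≫ asIso (D.pl.map (𝟙 X) e.hom) ≪≫ D.d X)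
    (fun {X Y} f => by
      change D.pl.map (D.pl.map f (𝟙 A)) (𝟙 B) ≫ (D.aP Y A B).inv ≫ D.pl.map (𝟙 Y) e.hom
          ≫ (D.d Y).hom
        = ((D.aP X A B).inv ≫ D.pl.map (𝟙 X) e.hom ≫ (D.d X).hom) ≫ f
      have nat := D.natAP f (𝟙 A) (𝟙 B)
      rw [← cancel_epi (D.aP X A B).hom, ← reassoc_of% nat, Iso.hom_inv_id_assoc, Bifunc.map_id]
      simp only [Category.assoc, Iso.hom_inv_id_assoc, ← D.natD, Bifunc.comp_map_assoc,
        Category.id_comp, Category.comp_id])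

theorem addRight_isEquivalence (hInv : invObjP D) (A : C) : (D.addRight A).IsEquivalence := by
  obtain ⟨B, ⟨e⟩⟩ := hInv A
  exact (CategoryTheory.Equivalence.mk (D.addRight A) (D.addRight B) (D.addRightCompIso e).symm
    (D.addRightCompIso (D.cP B A ≪≫ e))).isEquivalence_functor

/-- In a categorical group, a morphism `A ⊕ A ⟶ A` has a unique unit. -/
theorem existsUnique_unit (hG : grpdP C) (hInv : invObjP D) {A : C} (s : D.pl.obj A A ⟶ A) :
    ∃! φ : A ⟶ D.zero, s ≫ φ = D.pl.map φ φ ≫ (D.g D.zero).hom := by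
  have : (D.addRight A).IsEquivalence := addRight_isEquivalence hInv A
  have key (φ : A ⟶ D.zero) : s ≫ φ = D.pl.map φ φ ≫ (D.g D.zero).hom ↔
      D.pl.map φ (𝟙 A) = s ≫ (D.g A).inv := by
    have : IsIso φ := hG φ
    have split : D.pl.map φ φ = D.pl.map φ (𝟙 A) ≫ D.pl.map (𝟙 D.zero) φ := by
      rw [Bifunc.comp_map, Category.comp_id, Category.id_comp]
    rw [split, Category.assoc, D.natG, ← Category.assoc, cancel_mono, Iso.eq_comp_inv]
    exact eq_comm
  simp only [key]
  obtain ⟨φ, hφ⟩ := (D.addRight A).map_surjective (X := A) (Y := D.zero) (s ≫ (D.g A).inv)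
  exact ⟨φ, hφ, fun ψ hψ => (D.addRight A).map_injective (hψ.trans hφ.symm)⟩

theorem v_zero (hPentP : pentP D) (hTriP : triP D) (hHexP : hexP D) (hSymP : symP D) :
    v D D.zero D.zero D.zero D.zero = 𝟙 _ := by
  obtain ⟨hU, hE⟩ := D.pl.unit_coherence D.zero D.aP D.g D.d D.cP D.natAP D.natG D.natD D.natCP
    hPentP hTriP hHexP hSymP
  have hc : (D.cP D.zero D.zero).hom = 𝟙 _ := by
    rw [← cancel_mono (D.d D.zero).hom, hU, hE, Category.id_comp]
  simp [v, hc, Bifunc.map_id]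

theorem c00_of_diag4 (hPentP : pentP D) (hTriP : triP D) (hHexP : hexP D) (hSymP : symP D)
    (hG : grpdP C) (hInv : invObjP D) (h4 : diag4 D) (h6 : diag6 D) : c00 D := by
  have exU (X : C) := existsUnique_unit hG hInv
    ((D.dr D.zero D.zero X).inv ≫ D.tn.map (D.g D.zero).hom (𝟙 X))
  choose ρ hρ uρ using exU
  simp only [Category.assoc, Iso.inv_comp_eq] at hρ uρ
  -- `ρ` is natural and additive
  have natρ : D.tn.map (𝟙 D.zero) (D.g D.zero).hom ≫ ρ D.zero = ρ (D.pl.obj D.zero D.zero) := by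
    refine uρ _ _ ?_
    have nat := D.natDR (𝟙 D.zero) (𝟙 D.zero) (D.g D.zero).hom
    rw [Bifunc.map_id] at nat
    rw [← Bifunc.comp_map_assoc, ← reassoc_of% nat, ← hρ, Bifunc.comp_map_assoc,
      Bifunc.comp_map_assoc]
    simp
  have addρ : (D.dl D.zero D.zero D.zero).hom ≫ D.pl.map (ρ D.zero) (ρ D.zero)
      ≫ (D.g D.zero).hom = ρ (D.pl.obj D.zero D.zero) := by
    refine uρ _ _ ?_
    have nat := D.natDL (D.g D.zero).hom (𝟙 D.zero) (𝟙 D.zero)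
    rw [Bifunc.map_id] at nat
    have natv := D.v_natural (ρ D.zero) (ρ D.zero) (ρ D.zero) (ρ D.zero)
    rw [v_zero hPentP hTriP hHexP hSymP, Category.comp_id] at natv
    rw [reassoc_of% nat, ← Bifunc.comp_map_assoc, ← reassoc_of% (h4 D.zero D.zero D.zero D.zero),
      ← Bifunc.comp_map_assoc, ← reassoc_of% natv]
    simp only [Bifunc.comp_map_assoc, hρ]
  -- hence both `ρ 0` and `c ≫ ρ 0` are the unit of `0 ⊗ -` at `0`
  have uniq := (existsUnique_unit hG hInv ((D.dl D.zero D.zero D.zero).inv ≫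
    D.tn.map (𝟙 D.zero) (D.g D.zero).hom)).unique (y₁ := (D.br D.zero D.zero).hom ≫ ρ D.zero)
    (y₂ := ρ D.zero)
  simp only [Category.assoc, Iso.inv_comp_eq] at uniq
  have : IsIso (ρ D.zero) := hG _
  rw [c00, ← cancel_mono (ρ D.zero), Category.id_comp]
  refine uniq ?_ (natρ.trans addρ.symm)
  rw [reassoc_of% (D.natBr (𝟙 D.zero) (D.g D.zero).hom), hρ, ← Bifunc.comp_map_assoc,
    reassoc_of% (h6 D.zero D.zero D.zero)]

end Data

/-- **Proposition 6.3.** `𝒜` is a symmetric Ann-category iff: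
(i) `(𝒜, ⊕, a⁺, c⁺, (0,g,d))` is a symmetric categorical group;
(ii) `(𝒜, ⊗, a, c, (1,l,r))` is a symmetric monoidal category;
(iii) each `(L^A, 𝔏)` is a `⊕`-functor compatible with `a⁺` and `c⁺` and diagrams (1), (8) and
(5.1) commute; where in the `if` direction the right distributivity constraint is defined by
`ℜ_{X,Y,A} = (c_{A,X} ⊕ c_{A,Y}) ∘ 𝔏_{A,X,Y} ∘ c_{A,X⊕Y}⁻¹`. -/
theorem stmt11 {C : Type u} [Category.{v} C] (D : Data C) :
    IsSymAnn D ↔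
      ((pentP D ∧ triP D ∧ hexP D ∧ symP D ∧ grpdP C ∧ invObjP D)
        ∧ (pentT D ∧ triT D ∧ hexT1 D ∧ hexT2 D ∧ symT D)
        ∧ (compLaP D ∧ compLcP D ∧ diag1 D ∧ diag8 D ∧ diag51 D)
        ∧ drFormula D) := by
  constructor
  · rintro ⟨h, hS⟩
    have hR := Data.diag6_iff_drFormula.1 h.hD6
    exact ⟨⟨h.hPentP, h.hTriP, h.hHexP, h.hSymP, h.hGrpd, h.hInv⟩,
      ⟨h.hPentT, h.hTriT, h.hHex1, h.hHex2, hS⟩,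
      ⟨h.hCompLaP, h.hCompLcP, h.hD1, (Data.diag8_iff_diag4 hS hR).2 h.hD4, h.hD51⟩, hR⟩
  · rintro ⟨⟨hPentP, hTriP, hHexP, hSymP, hG, hInv⟩, ⟨hPentT, hTriT, hH1, hH2, hS⟩,
      ⟨hLaP, hLcP, hD1, hD8, hD51⟩, hR⟩
    have hD4 := (Data.diag8_iff_diag4 hS hR).1 hD8
    have hD6 := Data.diag6_iff_drFormula.2 hR
    have hU : brUnit D := (D.tn.unit_coherence D.one D.a D.l D.r D.br D.natA D.natL D.natR D.natBr
      hPentT hTriT hH1 hS).1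
    exact ⟨{
      hPentP := hPentP
      hTriP := hTriP
      hHexP := hHexP
      hSymP := hSymP
      hGrpd := hG
      hInv := hInv
      hPentT := hPentT
      hTriT := hTriT
      hCompLaP := hLaP
      hCompLcP := hLcP
      hCompRaP := Data.compRaP_of_drFormula hR hLaP
      hCompRcP := Data.compRcP_of_drFormula hR hLcP
      hD1 := hD1
      hD2 := Data.diag2_of_diag1 hS hR hH1 hH2 hD1
      hD3 := Data.diag3_of_diag1 hS hR hH1 hH2 hD1
      hD4 := hD4
      hD51 := hD51
      hD52 := Data.diag52_of_diag51 hS hR hU hD51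
      hHex1 := hH1
      hHex2 := hH2
      hD6 := hD6
      hC00 := Data.c00_of_diag4 hPentP hTriP hHexP hSymP hG hInv hD4 hD6 }, hS⟩

end AnnCat
end
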